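/- Let d ∈ N, t > 1/2, and fix ψ as in the context. Let X = S^t_{1,∞}B(T^d) be the normed space of all f ∈ L²(T^d) with finite norm ‖f‖_X = sup_{ℓ∈N_0^d} 2^{|ℓ|_1 t} ‖f_ℓ‖_{L¹(T^d)}, where |ℓ|_1 = ℓ_1 + … + ℓ_d and f_ℓ are the mixed dyadic blocks of f. Then the identity map I_d : X → L₂(T^d) is bounded, and there exist constants 0 < A ≤ B < ∞ (depending on d, t and ψ) such that A · (ln n)^{(d−1)t} · n^{1/2 − t} ≤ a_n(I_d : X → L₂(T^d)) ≤ B · (ln n)^{(d−1)t} · n^{1/2 − t} for all integers n ≥ 2. -/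

import Mathlib

open MeasureTheory Filter
open scoped ENNReal NNReal

noncomputable section

/-- The index lattice `ℤ^d`. -/
abbrev ZLat (d : ℕ) := Fin d → ℤ

instance fact_two_pi_pos : Fact (0 < 2 * Real.pi) := ⟨by positivity⟩

/-- The `d`-dimensional torus `𝕋^d = [0,2π]^d` with endpoints identified. -/
abbrev Torus (d : ℕ) := Fin d → AddCircle (2 * Real.pi)

/-- The normalized Lebesgue measure `(2π)^{-d} dx` on the `d`-torus. -/
def torusMeasure (d : ℕ) : Measure (Torus d) :=
  ((ENNReal.ofReal (2 * Real.pi))⁻¹) ^ d • Measure.pi fun _ => volume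

/-- The character `e^{i k·x}` on the `d`-torus. -/
def torusChar {d : ℕ} (k : ZLat d) (x : Torus d) : ℂ :=
  ∏ j, fourier (k j) (x j)

/-- The `k`-th Fourier coefficient `f̂(k) = (2π)^{-d} ∫_{𝕋^d} f(x) e^{-i k·x} dx`. -/
def fourierCoef {d : ℕ} (f : Torus d → ℂ) (k : ZLat d) : ℂ :=
  ∫ x, (starRingEnd ℂ) (torusChar k x) * f x ∂(torusMeasure d)

/-- The `n`-th approximation number of a bounded linear operator `T`:
`a_n(T) = inf {‖T - A‖ : rank A < n}`. -/
def approxNum {X Y : Type*} [NormedAddCommGroup X] [NormedSpace ℂ X]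
    [NormedAddCommGroup Y] [NormedSpace ℂ Y] (T : X →L[ℂ] Y) (n : ℕ) : ℝ :=
  sInf {c : ℝ | ∃ A : X →L[ℂ] Y,
    Module.rank ℂ (LinearMap.range (A : X →ₗ[ℂ] Y)) < n ∧ c = ‖T - A‖}

/-- `ℓ²(ℤ^d)`; an isometric model of the Hilbert space `F_d(w)` via `f ↦ (w(k)·f̂(k))_k`.
Under this identification the embedding `I_d : F_d(w) → G` is characterized by the
property that the function `T c` has Fourier coefficients `c(k)/w(k)`. -/
abbrev ellTwo (d : ℕ) := lp (fun _ : ZLat d => ℂ) 2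

/-- `ℓ¹(ℤ^d)`; an isometric model of the Wiener algebra `A(𝕋^d)` via `f ↦ (f̂(k))_k`. -/
abbrev ellOne (d : ℕ) := lp (fun _ : ZLat d => ℂ) 1

/-- `ℓ^∞(ℤ^d)`; an isometric model of the space `ℬ(𝕋^d)` of distributions with bounded
Fourier coefficients. -/
abbrev ellInfty (d : ℕ) := lp (fun _ : ZLat d => ℂ) ⊤

/-- The one-dimensional smooth dyadic decomposition of unity `(φ_j)_{j≥0}` generated
by `ψ`: `φ_0 = ψ` and `φ_j(ξ) = ψ(2^{-j}ξ) - ψ(2^{-j+1}ξ)` for `j ≥ 1`. -/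
def phi1 (ψ : ℝ → ℝ) : ℕ → ℝ → ℝ
  | 0 => ψ
  | j + 1 => fun ξ => ψ (((2 : ℝ)⁻¹ ^ (j + 1)) * ξ) - ψ (((2 : ℝ)⁻¹ ^ j) * ξ)

/-- The mixed dyadic block `f_ℓ(x) = ∑_k (∏_j φ_{ℓ_j}(k_j)) f̂(k) e^{i k·x}`,
`ℓ ∈ ℕ₀^d`, of a function on the `d`-torus. -/
def mixedBlock {d : ℕ} (ψ : ℝ → ℝ) (f : Torus d → ℂ) (ℓ : Fin d → ℕ)
    (x : Torus d) : ℂ :=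
  ∑' k : ZLat d,
    ((∏ j, phi1 ψ (ℓ j) ((k j : ℝ)) : ℝ) : ℂ) * fourierCoef f k * torusChar k x

open Finset (piAntidiag)
open Fintype (piFinset)

section TorusAnalysis

variable {d : ℕ}

lemma torusChar_add (k l : ZLat d) (x : Torus d) :
    torusChar (k + l) x = torusChar k x * torusChar l x := by
  simp only [torusChar, Pi.add_apply, fourier_add, ← Finset.prod_mul_distrib]

lemma torusChar_neg (k : ZLat d) (x : Torus d) :
    torusChar (-k) x = starRingEnd ℂ (torusChar k x) := by
  simp only [torusChar, Pi.neg_apply, fourier_neg, map_prod]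

lemma torusChar_zero (x : Torus d) : torusChar (0 : ZLat d) x = 1 := by
  simp only [torusChar, Pi.zero_apply, fourier_zero, Finset.prod_const_one]

lemma norm_torusChar (k : ZLat d) (x : Torus d) : ‖torusChar k x‖ = 1 := by
  simp only [torusChar, fourier_apply, norm_prod, Circle.norm_coe, Finset.prod_const_one]

/-- The characters as continuous functions. -/
def torusCharC (k : ZLat d) : C(Torus d, ℂ) where
  toFun := torusChar k
  continuous_toFun := by unfold torusChar; fun_prop

@[simp]
lemma torusCharC_apply (k : ZLat d) (x : Torus d) : torusCharC k x = torusChar k x := rfl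

lemma continuous_torusChar (k : ZLat d) : Continuous (torusChar k) := (torusCharC k).continuous

instance isProbabilityMeasure_torusMeasure (d : ℕ) : IsProbabilityMeasure (torusMeasure d) := by
  constructor
  have h : (0 : ℝ) < 2 * Real.pi := by positivity
  simp only [torusMeasure, Measure.smul_apply, Measure.pi_univ, AddCircle.measure_univ,
    Finset.prod_const, Finset.card_univ, Fintype.card_fin, smul_eq_mul, ← mul_pow]
  rw [ENNReal.inv_mul_cancel (by simpa using h) ENNReal.ofReal_ne_top, one_pow]

lemma integral_fourier_of_ne_zero {n : ℤ} (hn : n ≠ 0) :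
    ∫ x : AddCircle (2 * Real.pi), fourier n x = 0 := by
  refine integral_eq_zero_of_add_right_eq_neg (μ := volume)
    (g := ((2 * Real.pi / 2 / n : ℝ) : AddCircle (2 * Real.pi))) fun x => ?_
  exact fourier_add_half_inv_index hn fact_two_pi_pos.out x

lemma integral_torusChar (k : ZLat d) :
    ∫ x, torusChar k x ∂torusMeasure d = if k = 0 then 1 else 0 := by
  split_ifs with h
  · simp [h, torusChar_zero]
  · obtain ⟨i, hi⟩ := Function.ne_iff.mp h
    rw [torusMeasure, integral_smul_measure]
    simp only [torusChar]
    rw [integral_fintype_prod_eq_prod (fun j (x : AddCircle (2 * Real.pi)) => fourier (k j) x),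
      Finset.prod_eq_zero (Finset.mem_univ i) (integral_fourier_of_ne_zero hi), smul_zero]

lemma integral_conj_torusChar_mul (k l : ZLat d) :
    ∫ x, starRingEnd ℂ (torusChar k x) * torusChar l x ∂torusMeasure d =
      if k = l then 1 else 0 := by
  simp only [← torusChar_neg, ← torusChar_add, integral_torusChar]
  refine if_congr ?_ rfl rfl
  rw [neg_add_eq_zero]

/-- The star subalgebra of `C(𝕋^d, ℂ)` generated by the characters. -/
def torusSubalgebra (d : ℕ) : StarSubalgebra ℂ C(Torus d, ℂ) where
  toSubalgebra := Algebra.adjoin ℂ (Set.range torusCharC)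
  star_mem' := by
    change Algebra.adjoin ℂ (Set.range torusCharC) ≤
      star (Algebra.adjoin ℂ (Set.range torusCharC))
    refine Algebra.adjoin_le ?_
    rintro _ ⟨n, rfl⟩
    refine Algebra.subset_adjoin ⟨-n, ?_⟩
    ext1 x
    simp only [torusCharC_apply, torusChar_neg, starRingEnd_apply, ContinuousMap.star_apply]

lemma torusSubalgebra_coe :
    (torusSubalgebra d).toSubalgebra.toSubmodule = Submodule.span ℂ (Set.range torusCharC) := by
  apply Algebra.adjoin_eq_span_of_subset
  refine .trans (fun x ↦ Submonoid.closure_induction (fun _ ↦ id) ⟨0, ?_⟩ ?_)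
    Submodule.subset_span
  · ext z
    simp [torusChar_zero]
  · rintro _ _ _ _ ⟨m, rfl⟩ ⟨n, rfl⟩
    refine ⟨m + n, ?_⟩
    ext z
    simp [torusChar_add]

lemma torusSubalgebra_separatesPoints : (torusSubalgebra d).SeparatesPoints := by
  intro x y hxy
  rw [Ne, funext_iff, not_forall] at hxy
  obtain ⟨i, hi⟩ := hxy
  have key : ∀ z : Torus d, torusChar (Pi.single i 1) z = fourier 1 (z i) := by
    intro z
    rw [torusChar, Finset.prod_eq_single i]
    · simp
    · intro j _ hj
      rw [Pi.single_eq_of_ne hj, fourier_zero]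
    · simp
  refine ⟨_, ⟨torusCharC (Pi.single i 1), Algebra.subset_adjoin ⟨Pi.single i 1, rfl⟩, rfl⟩, ?_⟩
  change torusChar (Pi.single i 1) x ≠ torusChar (Pi.single i 1) y
  rw [key, key, fourier_one, fourier_one]
  contrapose hi
  exact AddCircle.injective_toCircle fact_two_pi_pos.out.ne' (Circle.ext hi)

lemma span_torusCharC_closure_eq_top :
    (Submodule.span ℂ (Set.range (torusCharC (d := d)))).topologicalClosure = ⊤ := by
  rw [← torusSubalgebra_coe]
  exact congr_arg (Subalgebra.toSubmodule <| StarSubalgebra.toSubalgebra ·)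
    (ContinuousMap.starSubalgebra_topologicalClosure_eq_top_of_separatesPoints _
      torusSubalgebra_separatesPoints)

/-- The characters as elements of `L²(𝕋^d)`. -/
def charL2 (k : ZLat d) : Lp ℂ 2 (torusMeasure d) :=
  ContinuousMap.toLp (E := ℂ) 2 (torusMeasure d) ℂ (torusCharC k)

lemma coeFn_charL2 (k : ZLat d) : charL2 k =ᵐ[torusMeasure d] torusChar k :=
  ContinuousMap.coeFn_toLp (torusMeasure d) (torusCharC k)

lemma span_charL2_closure_eq_top :
    (Submodule.span ℂ (Set.range (charL2 (d := d)))).topologicalClosure = ⊤ := by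
  have := (ContinuousMap.toLp_denseRange ℂ (torusMeasure d) ℂ
    (p := 2) (by simp)).topologicalClosure_map_submodule span_torusCharC_closure_eq_top
  simpa only [Submodule.map_span, ContinuousLinearMap.coe_coe, ← Set.range_comp,
    Function.comp_def] using! this

lemma inner_charL2_left (k : ZLat d) (f : Lp ℂ 2 (torusMeasure d)) :
    inner ℂ (charL2 k) f = fourierCoef f k := by
  rw [L2.inner_def, fourierCoef]
  refine integral_congr_ae ?_
  filter_upwards [coeFn_charL2 k] with x hx
  rw [RCLike.inner_apply, hx, mul_comm]

lemma fourierCoef_charL2 (k l : ZLat d) :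
    fourierCoef (charL2 l) k = if k = l then 1 else 0 := by
  rw [← integral_conj_torusChar_mul, fourierCoef]
  refine integral_congr_ae ?_
  filter_upwards [coeFn_charL2 l] with x hx
  rw [hx]

lemma orthonormal_charL2 : Orthonormal ℂ (charL2 (d := d)) := by
  rw [orthonormal_iff_ite]
  intro k l
  rw [inner_charL2_left, fourierCoef_charL2]

/-- The Fourier basis of `L²(𝕋^d)`. -/
def torusBasis (d : ℕ) : HilbertBasis (ZLat d) ℂ (Lp ℂ 2 (torusMeasure d)) :=
  HilbertBasis.mk orthonormal_charL2 span_charL2_closure_eq_top.ge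

lemma torusBasis_repr (f : Lp ℂ 2 (torusMeasure d)) (k : ZLat d) :
    (torusBasis d).repr f k = fourierCoef f k := by
  rw [HilbertBasis.repr_apply_apply, torusBasis, HilbertBasis.coe_mk, inner_charL2_left]

/-- Parseval's identity on the torus. -/
lemma hasSum_norm_sq_fourierCoef (f : Lp ℂ 2 (torusMeasure d)) :
    HasSum (fun k => ‖fourierCoef f k‖ ^ 2) (‖f‖ ^ 2) := by
  have h := lp.hasSum_norm (p := 2) (by simp) ((torusBasis d).repr f)
  simpa [torusBasis_repr] using h

end TorusAnalysis

section DyadicBlocks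

variable {d : ℕ} {ψ : ℝ → ℝ}

lemma abs_inv_two_pow_mul (j : ℕ) (ξ : ℝ) : |(2 : ℝ)⁻¹ ^ j * ξ| = |ξ| / 2 ^ j := by
  rw [abs_mul, abs_of_nonneg (by positivity), inv_pow, mul_comm, div_eq_mul_inv]

lemma psi_scaled_eq_zero (hψsupp : ∀ ξ : ℝ, 3 / 2 < |ξ| → ψ ξ = 0) {j : ℕ} {ξ : ℝ}
    (h : 3 / 2 * 2 ^ j < |ξ|) : ψ ((2 : ℝ)⁻¹ ^ j * ξ) = 0 := by
  apply hψsupp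
  rwa [abs_inv_two_pow_mul, lt_div_iff₀ (by positivity)]

lemma psi_scaled_eq_one (hψone : ∀ ξ : ℝ, |ξ| ≤ 1 → ψ ξ = 1) {j : ℕ} {ξ : ℝ}
    (h : |ξ| ≤ 2 ^ j) : ψ ((2 : ℝ)⁻¹ ^ j * ξ) = 1 := by
  apply hψone
  rwa [abs_inv_two_pow_mul, div_le_one (by positivity)]

lemma phi1_zero_eq (ψ : ℝ → ℝ) (ξ : ℝ) : phi1 ψ 0 ξ = ψ ((2 : ℝ)⁻¹ ^ 0 * ξ) := by
  simp [phi1]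

lemma phi1_succ_eq (ψ : ℝ → ℝ) (j : ℕ) (ξ : ℝ) :
    phi1 ψ (j + 1) ξ = ψ ((2 : ℝ)⁻¹ ^ (j + 1) * ξ) - ψ ((2 : ℝ)⁻¹ ^ j * ξ) := rfl

lemma phi1_eq_zero (hψsupp : ∀ ξ : ℝ, 3 / 2 < |ξ| → ψ ξ = 0) {j : ℕ} {ξ : ℝ}
    (h : 3 / 2 * 2 ^ j < |ξ|) : phi1 ψ j ξ = 0 := by
  cases j with
  | zero => rw [phi1_zero_eq, psi_scaled_eq_zero hψsupp h]
  | succ j =>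
    have h' : 3 / 2 * (2 : ℝ) ^ j < |ξ| := by
      rw [pow_succ] at h
      linarith [pow_pos (two_pos : (0 : ℝ) < 2) j]
    rw [phi1_succ_eq, psi_scaled_eq_zero hψsupp h, psi_scaled_eq_zero hψsupp h', sub_zero]

/-- On the core of the `j`-th dyadic annulus only `φ_j` is nonzero, and it equals one there. -/
lemma phi1_core (hψsupp : ∀ ξ : ℝ, 3 / 2 < |ξ| → ψ ξ = 0)
    (hψone : ∀ ξ : ℝ, |ξ| ≤ 1 → ψ ξ = 1) {i j : ℕ} (hj : 1 ≤ j) {ξ : ℝ}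
    (h₁ : 3 / 4 * 2 ^ j < |ξ|) (h₂ : |ξ| ≤ 2 ^ j) :
    phi1 ψ i ξ = if i = j then 1 else 0 := by
  rcases lt_trichotomy i j with h | h | h
  · rw [if_neg h.ne]
    apply phi1_eq_zero hψsupp
    refine lt_of_le_of_lt ?_ h₁
    have : (2 : ℝ) ^ (i + 1) ≤ 2 ^ j := pow_le_pow_right₀ one_le_two h
    rw [pow_succ] at this
    linarith
  · subst h
    obtain ⟨i, rfl⟩ : ∃ m, i = m + 1 := ⟨i - 1, by omega⟩
    rw [if_pos rfl, phi1_succ_eq, psi_scaled_eq_one hψone h₂, psi_scaled_eq_zero hψsupp, sub_zero]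
    rw [pow_succ] at h₁
    linarith
  · rw [if_neg h.ne']
    obtain ⟨i, rfl⟩ : ∃ m, i = m + 1 := ⟨i - 1, by omega⟩
    have h' : j ≤ i := by omega
    rw [phi1_succ_eq, psi_scaled_eq_one hψone, psi_scaled_eq_one hψone, sub_self]
    · exact h₂.trans (pow_le_pow_right₀ one_le_two h')
    · exact h₂.trans (pow_le_pow_right₀ one_le_two h.le)

lemma exists_half_le_phi1 (hψsupp : ∀ ξ : ℝ, 3 / 2 < |ξ| → ψ ξ = 0)
    (hψone : ∀ ξ : ℝ, |ξ| ≤ 1 → ψ ξ = 1) (ξ : ℝ) : ∃ j, 1 / 2 ≤ phi1 ψ j ξ := by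
  classical
  have hex : ∃ j : ℕ, |ξ| ≤ (2 : ℝ) ^ j :=
    (pow_unbounded_of_one_lt |ξ| one_lt_two).imp fun _ h => h.le
  have hspec := psi_scaled_eq_one hψone (Nat.find_spec hex)
  have hmin : ∀ i < Nat.find hex, (2 : ℝ) ^ i < |ξ| := fun i hi =>
    not_le.mp (Nat.find_min hex hi)
  generalize Nat.find hex = j at hspec hmin
  match j with
  | 0 => exact ⟨0, by rw [phi1_zero_eq, hspec]; norm_num⟩
  | 1 =>
    by_contra! h
    have h0 := h 0
    have h1 := h 1
    rw [phi1_zero_eq] at h0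
    rw [phi1_succ_eq, hspec] at h1
    linarith
  | j + 2 =>
    by_contra! h
    have h0 := h (j + 1)
    have h1 := h (j + 2)
    rw [phi1_succ_eq, psi_scaled_eq_zero (j := j) hψsupp] at h0
    · rw [phi1_succ_eq, hspec] at h1
      linarith
    · have := hmin (j + 1) (by omega)
      rw [pow_succ] at this
      linarith [pow_pos (two_pos : (0 : ℝ) < 2) j]

/-- The product multiplier of the mixed dyadic block of index `ℓ`. -/
def phiProd (ψ : ℝ → ℝ) (ℓ : Fin d → ℕ) (k : ZLat d) : ℝ := ∏ j, phi1 ψ (ℓ j) (k j)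

/-- A finite box containing all frequencies of the mixed dyadic block of index `ℓ`. -/
def blockBox (ℓ : Fin d → ℕ) : Finset (ZLat d) :=
  piFinset fun j => Finset.Ioo (-2 ^ (ℓ j + 1)) (2 ^ (ℓ j + 1))

lemma mem_blockBox_of_phiProd_ne_zero (hψsupp : ∀ ξ : ℝ, 3 / 2 < |ξ| → ψ ξ = 0)
    {ℓ : Fin d → ℕ} {k : ZLat d} (h : phiProd ψ ℓ k ≠ 0) : k ∈ blockBox ℓ := by
  rw [blockBox, Fintype.mem_piFinset]
  intro j
  have hj : phi1 ψ (ℓ j) (k j) ≠ 0 := (Finset.prod_ne_zero_iff.mp h) j (Finset.mem_univ j)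
  have hle : |(k j : ℝ)| ≤ 3 / 2 * 2 ^ ℓ j := by
    by_contra! hlt
    exact hj (phi1_eq_zero hψsupp hlt)
  have hlt : |(k j : ℝ)| < 2 ^ (ℓ j + 1) := by
    rw [pow_succ]
    linarith [pow_pos (two_pos : (0 : ℝ) < 2) (ℓ j)]
  rw [Finset.mem_Ioo, ← abs_lt]
  exact_mod_cast hlt

lemma card_blockBox_le (ℓ : Fin d → ℕ) : (blockBox ℓ).card ≤ 4 ^ d * 2 ^ ∑ j, ℓ j := by
  rw [blockBox, Fintype.card_piFinset]
  calc ∏ j, (Finset.Ioo (-2 ^ (ℓ j + 1) : ℤ) (2 ^ (ℓ j + 1))).card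
      ≤ ∏ j, 4 * 2 ^ ℓ j := by
        refine Finset.prod_le_prod' fun j _ => ?_
        rw [Int.card_Ioo, Int.toNat_le]
        push_cast
        rw [pow_succ]
        omega
    _ = 4 ^ d * 2 ^ ∑ j, ℓ j := by
        rw [Finset.prod_mul_distrib, Finset.prod_const, Finset.card_univ, Fintype.card_fin,
          Finset.prod_pow_eq_pow_sum]

lemma mixedBlock_eq_sum {K : Finset (ZLat d)} {f : Torus d → ℂ} {ℓ : Fin d → ℕ}
    (hK : ∀ k ∉ K, (phiProd ψ ℓ k : ℂ) * fourierCoef f k = 0) (z : Torus d) :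
    mixedBlock ψ f ℓ z = ∑ k ∈ K, (phiProd ψ ℓ k : ℂ) * fourierCoef f k * torusChar k z := by
  rw [mixedBlock]
  refine tsum_eq_sum (f := fun k => (phiProd ψ ℓ k : ℂ) * fourierCoef f k * torusChar k z)
    fun k hk => ?_
  rw [hK k hk, zero_mul]

lemma norm_coef_le_integral_norm (K : Finset (ZLat d)) (a : ZLat d → ℂ) {k : ZLat d}
    (hk : k ∈ K) :
    ‖a k‖ ≤ ∫ z, ‖∑ l ∈ K, a l * torusChar l z‖ ∂torusMeasure d := by
  have h : a k = ∫ z, starRingEnd ℂ (torusChar k z) * ∑ l ∈ K, a l * torusChar l z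
      ∂torusMeasure d := by
    have h1 : ∀ z : Torus d, starRingEnd ℂ (torusChar k z) * ∑ l ∈ K, a l * torusChar l z =
        ∑ l ∈ K, a l * (starRingEnd ℂ (torusChar k z) * torusChar l z) := by
      intro z
      rw [Finset.mul_sum]
      exact Finset.sum_congr rfl fun l _ => by ring
    simp_rw [h1]
    rw [integral_finsetSum]
    · simp_rw [integral_const_mul, integral_conj_torusChar_mul]
      simp [hk]
    · intro l _
      refine Continuous.integrable_of_hasCompactSupport ?_ (HasCompactSupport.of_compactSpace _)
      have := continuous_torusChar k
      have := continuous_torusChar l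
      fun_prop
  conv_lhs => rw [h]
  refine (norm_integral_le_integral_norm _).trans_eq ?_
  simp [norm_torusChar]

lemma norm_phiProd_mul_fourierCoef_le (hψsupp : ∀ ξ : ℝ, 3 / 2 < |ξ| → ψ ξ = 0)
    (f : Torus d → ℂ) (ℓ : Fin d → ℕ) (k : ZLat d) :
    ‖(phiProd ψ ℓ k : ℂ) * fourierCoef f k‖ ≤ ∫ z, ‖mixedBlock ψ f ℓ z‖ ∂torusMeasure d := by
  by_cases hk : k ∈ blockBox ℓ
  · have hK : ∀ k ∉ blockBox ℓ, (phiProd ψ ℓ k : ℂ) * fourierCoef f k = 0 := by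
      intro k hk
      rw [not_imp_comm.mp (mem_blockBox_of_phiProd_ne_zero hψsupp) hk]
      simp
    simp_rw [mixedBlock_eq_sum hK]
    exact norm_coef_le_integral_norm (blockBox ℓ)
      (fun k => (phiProd ψ ℓ k : ℂ) * fourierCoef f k) hk
  · rw [not_imp_comm.mp (mem_blockBox_of_phiProd_ne_zero hψsupp) hk]
    simpa using integral_nonneg fun z => norm_nonneg _

/-- Every frequency belongs substantially to some mixed dyadic block. -/
lemma exists_level (hψsupp : ∀ ξ : ℝ, 3 / 2 < |ξ| → ψ ξ = 0)
    (hψone : ∀ ξ : ℝ, |ξ| ≤ 1 → ψ ξ = 1) :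
    ∃ lev : ZLat d → Fin d → ℕ, ∀ k, (1 / 2 : ℝ) ^ d ≤ phiProd ψ (lev k) k := by
  choose j hj using fun ξ : ℝ => exists_half_le_phi1 hψsupp hψone ξ
  refine ⟨fun k i => j (k i), fun k => ?_⟩
  calc (1 / 2 : ℝ) ^ d = ∏ _i : Fin d, (1 / 2 : ℝ) := by simp
    _ ≤ _ := Finset.prod_le_prod (fun _ _ => by norm_num) fun i _ => hj _

end DyadicBlocks

section Counting

lemma card_piAntidiag_fin_le {d : ℕ} (hd : 0 < d) (s : ℕ) :
    (piAntidiag (Finset.univ : Finset (Fin d)) s).card ≤ (s + 1) ^ (d - 1) := by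
  obtain ⟨e, rfl⟩ : ∃ e, d = e + 1 := ⟨d - 1, by omega⟩
  have h : (piFinset fun _ : Fin e => Finset.range (s + 1)).card = (s + 1) ^ e := by simp
  rw [Nat.add_sub_cancel, ← h]
  refine Finset.card_le_card_of_injOn Fin.tail ?_ ?_
  · intro v hv
    have hv' : ∑ j, v j = s := by simpa using hv
    simp only [Fintype.coe_piFinset, Set.mem_pi, Finset.coe_range, Set.mem_Iio]
    intro j _
    have := Finset.single_le_sum (f := v) (fun _ _ => Nat.zero_le _) (Finset.mem_univ j.succ)
    simp only [Fin.tail]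
    omega
  · intro v hv w hw hvw
    have hv' : v 0 + ∑ j, Fin.tail v j = s := by simpa [Fin.sum_univ_succ, Fin.tail] using hv
    have hw' : w 0 + ∑ j, Fin.tail w j = s := by simpa [Fin.sum_univ_succ, Fin.tail] using hw
    rw [← Fin.cons_self_tail v, ← Fin.cons_self_tail w, hvw]
    congr 1
    rw [hvw] at hv'
    omega

lemma pow_le_card_piAntidiag_fin {d : ℕ} (hd : 0 < d) (s : ℕ) :
    (s + 1) ^ (d - 1) ≤
      d ^ (d - 1) * (piAntidiag (Finset.univ : Finset (Fin d)) s).card := by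
  obtain ⟨e, rfl⟩ : ∃ e, d = e + 1 := ⟨d - 1, by omega⟩
  have h : (piFinset fun _ : Fin e => Finset.range (s / (e + 1) + 1)).card =
    (s / (e + 1) + 1) ^ e := by simp
  have hcard : (s / (e + 1) + 1) ^ e ≤
      (piAntidiag (Finset.univ : Finset (Fin (e + 1))) s).card := by
    rw [← h]
    refine Finset.card_le_card_of_injOn
      (fun v => (Fin.cons (s - ∑ j, v j) v : Fin (e + 1) → ℕ)) ?_ ?_
    · intro v hv
      have hv' : ∀ j, v j ≤ s / (e + 1) := by
        intro j
        have := Finset.mem_range.mp (Fintype.mem_piFinset.mp hv j)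
        omega
      have hsum : ∑ j, v j ≤ s := by
        calc ∑ j, v j ≤ ∑ _j : Fin e, s / (e + 1) := Finset.sum_le_sum fun j _ => hv' j
          _ = e * (s / (e + 1)) := by simp
          _ ≤ (e + 1) * (s / (e + 1)) := Nat.mul_le_mul_right _ (Nat.le_succ e)
          _ ≤ s := Nat.mul_div_le s (e + 1)
      simp [Fin.sum_univ_succ, hsum]
    · intro v _ w _ hvw
      exact (Fin.cons_inj.mp hvw).2
  rw [Nat.add_sub_cancel]
  refine le_trans ?_ (Nat.mul_le_mul_left _ hcard)
  rw [← mul_pow]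
  refine Nat.pow_le_pow_left ?_ e
  have := Nat.lt_div_mul_add (a := s) (b := e + 1) (Nat.succ_pos e)
  rw [mul_add, mul_one, mul_comm]
  omega

lemma sum_range_mul_two_pow_le (e m : ℕ) :
    ∑ s ∈ Finset.range m, (s + 1) ^ e * 2 ^ s ≤ (m + 1) ^ e * (2 ^ m - 1) := by
  have hgeom : ∑ s ∈ Finset.range m, 2 ^ s = 2 ^ m - 1 := by simpa using Nat.geomSum_eq le_rfl m
  rw [← hgeom, Finset.mul_sum]
  refine Finset.sum_le_sum fun s hs => Nat.mul_le_mul_right _ (Nat.pow_le_pow_left ?_ e)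
  have := Finset.mem_range.mp hs
  omega

/-- Tails of `∑ (s+1)^e q^s` are comparable with their first term. -/
lemma exists_sum_Ico_le (e : ℕ) {q : ℝ} (hq0 : 0 < q) (hq1 : q < 1) :
    ∃ S : ℝ, 0 < S ∧ ∀ m M : ℕ,
      ∑ s ∈ Finset.Ico m M, ((s : ℝ) + 1) ^ e * q ^ s ≤ S * (((m : ℝ) + 1) ^ e * q ^ m) := by
  have hsum : Summable fun r : ℕ => ((r : ℝ) + 1) ^ e * q ^ r := by
    have h := (summable_nat_add_iff 1).mpr (summable_pow_mul_geometric_of_norm_lt_one e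
      (r := q) (by rwa [Real.norm_of_nonneg hq0.le]))
    refine (h.mul_left q⁻¹).congr fun r => ?_
    push_cast
    field_simp
    ring
  have hnn : ∀ r : ℕ, 0 ≤ ((r : ℝ) + 1) ^ e * q ^ r := fun r => by positivity
  refine ⟨∑' r : ℕ, ((r : ℝ) + 1) ^ e * q ^ r,
    hsum.tsum_pos hnn 0 (by simp), fun m M => ?_⟩
  rw [Finset.sum_Ico_eq_sum_range]
  calc ∑ r ∈ Finset.range (M - m), (((m + r : ℕ) : ℝ) + 1) ^ e * q ^ (m + r)
      ≤ ∑ r ∈ Finset.range (M - m),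
          (((r : ℝ) + 1) ^ e * q ^ r) * (((m : ℝ) + 1) ^ e * q ^ m) := by
        refine Finset.sum_le_sum fun r _ => ?_
        have h : (((m + r : ℕ) : ℝ) + 1) ^ e ≤ (((r : ℝ) + 1) * ((m : ℝ) + 1)) ^ e := by
          refine pow_le_pow_left₀ (by positivity) ?_ e
          push_cast
          nlinarith [mul_nonneg (Nat.cast_nonneg (α := ℝ) m) (Nat.cast_nonneg (α := ℝ) r)]
        rw [mul_pow] at h
        calc _ ≤ ((r : ℝ) + 1) ^ e * ((m : ℝ) + 1) ^ e * q ^ (m + r) :=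
              mul_le_mul_of_nonneg_right h (by positivity)
          _ = _ := by rw [pow_add]; ring
    _ ≤ _ := by
        rw [← Finset.sum_mul]
        exact mul_le_mul_of_nonneg_right (hsum.sum_le_tsum _ fun r _ => hnn r) (by positivity)

lemma sum_filter_le_sum_Ico {ι : Type*} {lv : ι → ℕ} {G : ℕ → Finset ι}
    (hG : ∀ k s, k ∈ G s ↔ lv k = s) {a : ι → ℝ} {b : ℕ → ℝ} (hab : ∀ k, a k ≤ b (lv k))
    (hb : ∀ s, 0 ≤ b s) (m : ℕ) (F : Finset ι) :
    ∃ M : ℕ, ∑ k ∈ F with m ≤ lv k, a k ≤ ∑ s ∈ Finset.Ico m M, (G s).card * b s := by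
  classical
  refine ⟨F.sup lv + 1, ?_⟩
  rw [← Finset.sum_fiberwise_of_maps_to (t := Finset.Ico m (F.sup lv + 1)) (g := lv)]
  · refine Finset.sum_le_sum fun s _ => ?_
    calc ∑ k ∈ {k ∈ F | m ≤ lv k} with lv k = s, a k
        ≤ ∑ k ∈ {k ∈ F | m ≤ lv k} with lv k = s, b s := by
          refine Finset.sum_le_sum fun k hk => ?_
          rw [← (Finset.mem_filter.mp hk).2]
          exact hab k
      _ ≤ ∑ k ∈ G s, b s := by
          refine Finset.sum_le_sum_of_subset_of_nonneg ?_ fun _ _ _ => hb s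
          intro k hk
          exact (hG k s).mpr (Finset.mem_filter.mp hk).2
      _ = _ := by rw [Finset.sum_const, nsmul_eq_mul]
  · intro k hk
    rw [Finset.mem_filter] at hk
    exact Finset.mem_Ico.mpr ⟨hk.2, Nat.lt_succ_of_le (Finset.le_sup hk.1)⟩

end Counting

section CoefficientDecay

variable {d : ℕ} {ψ : ℝ → ℝ}

/-- The frequencies split into finite levels of hyperbolic-cross size on which the Fourier
coefficients are controlled by the mixed dyadic blocks. -/
lemma exists_levels (hd : 0 < d) (hψsupp : ∀ ξ : ℝ, 3 / 2 < |ξ| → ψ ξ = 0)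
    (hψone : ∀ ξ : ℝ, |ξ| ≤ 1 → ψ ξ = 1) (t : ℝ) :
    ∃ (lv : ZLat d → ℕ) (G : ℕ → Finset (ZLat d)), (∀ k s, k ∈ G s ↔ lv k = s) ∧
      (∀ s, (G s).card ≤ 4 ^ d * ((s + 1) ^ (d - 1) * 2 ^ s)) ∧
      ∀ (f : Torus d → ℂ) (R : ℝ), (∀ ℓ : Fin d → ℕ, (2 : ℝ) ^ ((∑ j, (ℓ j : ℝ)) * t) *
        ∫ z, ‖mixedBlock ψ f ℓ z‖ ∂torusMeasure d ≤ R) →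
      ∀ k, ‖fourierCoef f k‖ ≤ 2 ^ d * (2 : ℝ) ^ (-(lv k * t)) * R := by
  classical
  obtain ⟨lev, hlev⟩ := exists_level (d := d) hψsupp hψone
  have hpos : (0 : ℝ) < (1 / 2) ^ d := by positivity
  have hbox : ∀ k, k ∈ blockBox (lev k) := fun k =>
    mem_blockBox_of_phiProd_ne_zero hψsupp (hpos.trans_le (hlev k)).ne'
  refine ⟨fun k => ∑ j, lev k j, fun s => {k ∈ (piAntidiag Finset.univ s).biUnion blockBox |
    ∑ j, lev k j = s}, ?_, ?_, ?_⟩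
  · intro k s
    rw [Finset.mem_filter, and_iff_right_iff_imp]
    intro h
    exact Finset.mem_biUnion.mpr ⟨lev k, by simpa using h, hbox k⟩
  · intro s
    refine (Finset.card_filter_le _ _).trans (Finset.card_biUnion_le.trans ?_)
    calc ∑ ℓ ∈ piAntidiag (Finset.univ : Finset (Fin d)) s, (blockBox ℓ).card
        ≤ ∑ ℓ ∈ piAntidiag (Finset.univ : Finset (Fin d)) s, 4 ^ d * 2 ^ s := by
          refine Finset.sum_le_sum fun ℓ hℓ => (card_blockBox_le ℓ).trans_eq ?_
          rw [(Finset.mem_piAntidiag.mp hℓ).1]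
      _ ≤ (s + 1) ^ (d - 1) * (4 ^ d * 2 ^ s) := by
          rw [Finset.sum_const, smul_eq_mul]
          exact Nat.mul_le_mul_right _ (card_piAntidiag_fin_le hd s)
      _ = _ := by ring
  · intro f R hR k
    have h1 := norm_phiProd_mul_fourierCoef_le hψsupp f (lev k) k
    have h2 := hR (lev k)
    rw [norm_mul, Complex.norm_real, Real.norm_of_nonneg (hpos.le.trans (hlev k))] at h1
    have h3 : (1 / 2 : ℝ) ^ d * ‖fourierCoef f k‖ ≤ (2 : ℝ) ^ (-((∑ j, (lev k j : ℝ)) * t)) * R := by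
      refine ((mul_le_mul_of_nonneg_right (hlev k) (norm_nonneg _)).trans h1).trans ?_
      rw [Real.rpow_neg zero_le_two, ← div_eq_inv_mul, le_div_iff₀ (by positivity), mul_comm]
      exact h2
    have h4 : ‖fourierCoef f k‖ = 2 ^ d * ((1 / 2 : ℝ) ^ d * ‖fourierCoef f k‖) := by
      rw [← mul_assoc, ← mul_pow]
      norm_num
    rw [h4, mul_assoc]
    push_cast
    exact mul_le_mul_of_nonneg_left h3 (by positivity)

end CoefficientDecay

section UpperBound

variable {d : ℕ} {ψ : ℝ → ℝ}

lemma fourierCoef_sub_sum (f : Lp ℂ 2 (torusMeasure d)) (H : Finset (ZLat d)) (k : ZLat d)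
    [Decidable (k ∈ H)] :
    fourierCoef (f - ∑ l ∈ H, fourierCoef f l • charL2 l : Lp ℂ 2 (torusMeasure d)) k =
      if k ∈ H then 0 else fourierCoef f k := by
  classical
  rw [← inner_charL2_left, inner_sub_right, inner_sum, inner_charL2_left]
  simp_rw [inner_smul_right, inner_charL2_left, fourierCoef_charL2]
  by_cases hk : k ∈ H <;> simp [hk]

lemma norm_sq_sub_sum_le (f : Lp ℂ 2 (torusMeasure d)) (H : Finset (ZLat d))
    [DecidablePred (· ∈ H)] {B : ℝ}
    (hB : ∀ F : Finset (ZLat d), ∑ k ∈ F with k ∉ H, ‖fourierCoef f k‖ ^ 2 ≤ B) :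
    ‖f - ∑ l ∈ H, fourierCoef f l • charL2 l‖ ^ 2 ≤ B := by
  refine hasSum_le_of_sum_le (hasSum_norm_sq_fourierCoef _) fun F => ?_
  simp_rw [fourierCoef_sub_sum]
  refine le_trans (le_of_eq ?_) (hB F)
  rw [Finset.sum_filter]
  refine Finset.sum_congr rfl fun k _ => ?_
  by_cases hk : k ∈ H <;> simp [hk]

/-- The blocks of an element are controlled by its norm; the supremum defining the norm is never
a junk value. -/
lemma block_le_norm {t : ℝ} {X : Type*} [NormedAddCommGroup X] [NormedSpace ℂ X]
    {J : X →ₗ[ℂ] Lp ℂ 2 (torusMeasure d)}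
    (hJnorm : ∀ x : X, ‖x‖ = ⨆ ℓ : Fin d → ℕ,
      (2 : ℝ) ^ ((∑ j, (ℓ j : ℝ)) * t) *
        ∫ z, ‖mixedBlock ψ (⇑(J x)) ℓ z‖ ∂torusMeasure d) (x : X) (ℓ : Fin d → ℕ) :
    (2 : ℝ) ^ ((∑ j, (ℓ j : ℝ)) * t) *
      ∫ z, ‖mixedBlock ψ (⇑(J x)) ℓ z‖ ∂torusMeasure d ≤ ‖x‖ := by
  by_cases hb : BddAbove (Set.range fun ℓ : Fin d → ℕ => (2 : ℝ) ^ ((∑ j, (ℓ j : ℝ)) * t) *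
      ∫ z, ‖mixedBlock ψ (⇑(J x)) ℓ z‖ ∂torusMeasure d)
  · rw [hJnorm]
    exact le_ciSup hb ℓ
  · have hx : x = 0 := by rw [← norm_eq_zero, hJnorm, Real.iSup_of_not_bddAbove hb]
    have hcoef : ∀ k, fourierCoef (⇑(0 : Lp ℂ 2 (torusMeasure d))) k = 0 := fun k => by
      rw [← inner_charL2_left, inner_zero_right]
    have hblock : ∀ z, mixedBlock ψ (⇑(J x)) ℓ z = 0 := fun z => by
      rw [hx, map_zero, mixedBlock]
      simp only [hcoef, mul_zero, zero_mul, tsum_zero]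
    simp_rw [hblock, norm_zero, integral_zero, mul_zero]
    exact norm_nonneg x

lemma approxNum_le {X Y : Type*} [NormedAddCommGroup X] [NormedSpace ℂ X]
    [NormedAddCommGroup Y] [NormedSpace ℂ Y] (T A : X →L[ℂ] Y) {n : ℕ}
    (hA : Module.rank ℂ (LinearMap.range (A : X →ₗ[ℂ] Y)) < n) : approxNum T n ≤ ‖T - A‖ := by
  refine csInf_le ⟨0, ?_⟩ ⟨A, hA, rfl⟩
  rintro _ ⟨A', _, rfl⟩
  exact norm_nonneg _

/-- The embedding is bounded, and truncation to hyperbolic crosses bounds its approximation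
numbers from above. -/
lemma exists_embedding_approxNum_le (hd : 0 < d) {t : ℝ} (ht : 1 / 2 < t)
    (hψsupp : ∀ ξ : ℝ, 3 / 2 < |ξ| → ψ ξ = 0) (hψone : ∀ ξ : ℝ, |ξ| ≤ 1 → ψ ξ = 1)
    {X : Type*} [NormedAddCommGroup X] [NormedSpace ℂ X]
    (J : X →ₗ[ℂ] Lp ℂ 2 (torusMeasure d))
    (hJnorm : ∀ x : X, ‖x‖ = ⨆ ℓ : Fin d → ℕ,
      (2 : ℝ) ^ ((∑ j, (ℓ j : ℝ)) * t) *
        ∫ z, ‖mixedBlock ψ (⇑(J x)) ℓ z‖ ∂torusMeasure d) :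
    ∃ T : X →L[ℂ] Lp ℂ 2 (torusMeasure d), (∀ x, T x = J x) ∧
      ∃ C : ℝ, 0 < C ∧ ∀ m n : ℕ, 4 ^ d * ((m + 1) ^ (d - 1) * (2 ^ m - 1)) < n →
        approxNum T n ≤ √(C * (((m : ℝ) + 1) ^ (d - 1) * ((2 : ℝ) ^ (1 - 2 * t)) ^ m)) := by
  classical
  obtain ⟨lv, G, hG, hcard, hcoef⟩ := exists_levels hd hψsupp hψone t
  set q : ℝ := (2 : ℝ) ^ (1 - 2 * t) with hq
  have hq0 : 0 < q := by positivity
  have hq1 : q < 1 := Real.rpow_lt_one_of_one_lt_of_neg one_lt_two (by linarith)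
  obtain ⟨S, hS, hsum⟩ := exists_sum_Ico_le (d - 1) hq0 hq1
  have htail : ∀ (x : X) (m : ℕ) (F : Finset (ZLat d)),
      ∑ k ∈ F with m ≤ lv k, ‖fourierCoef (J x) k‖ ^ 2 ≤
        16 ^ d * S * (((m : ℝ) + 1) ^ (d - 1) * q ^ m) * ‖x‖ ^ 2 := by
    intro x m F
    have hterm : ∀ k, ‖fourierCoef (J x) k‖ ^ 2 ≤ 4 ^ d * (q / 2) ^ lv k * ‖x‖ ^ 2 := by
      intro k
      have h := hcoef (J x) ‖x‖ (fun ℓ => block_le_norm hJnorm x ℓ) k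
      have hp : ((2 : ℝ) ^ (-(lv k * t))) ^ 2 = (q / 2) ^ lv k := by
        have : q / 2 = (2 : ℝ) ^ (-2 * t) := by
          rw [hq, div_eq_iff two_ne_zero, ← Real.rpow_add_one two_ne_zero]
          ring_nf
        rw [this, ← Real.rpow_natCast, ← Real.rpow_natCast, ← Real.rpow_mul zero_le_two,
          ← Real.rpow_mul zero_le_two]
        push_cast
        ring_nf
      calc ‖fourierCoef (J x) k‖ ^ 2 ≤ (2 ^ d * (2 : ℝ) ^ (-(lv k * t)) * ‖x‖) ^ 2 :=
            pow_le_pow_left₀ (norm_nonneg _) h 2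
        _ = _ := by
            rw [mul_pow, mul_pow, hp, ← pow_mul, mul_comm d 2, pow_mul]
            norm_num
    obtain ⟨M, hM⟩ := sum_filter_le_sum_Ico hG
      (b := fun s => 4 ^ d * (q / 2) ^ s * ‖x‖ ^ 2) hterm (fun s => by positivity) m F
    refine hM.trans ?_
    calc ∑ s ∈ Finset.Ico m M, ((G s).card : ℝ) * (4 ^ d * (q / 2) ^ s * ‖x‖ ^ 2)
        ≤ ∑ s ∈ Finset.Ico m M, 16 ^ d * ‖x‖ ^ 2 * (((s : ℝ) + 1) ^ (d - 1) * q ^ s) := by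
          refine Finset.sum_le_sum fun s _ => ?_
          have hc : ((G s).card : ℝ) ≤ 4 ^ d * (((s : ℝ) + 1) ^ (d - 1) * 2 ^ s) := by
            exact_mod_cast hcard s
          refine (mul_le_mul_of_nonneg_right hc (by positivity)).trans_eq ?_
          have h16 : (16 : ℝ) ^ d = 4 ^ d * 4 ^ d := by rw [← mul_pow]; norm_num
          rw [h16, div_pow]
          field_simp
      _ ≤ 16 ^ d * ‖x‖ ^ 2 * (S * (((m : ℝ) + 1) ^ (d - 1) * q ^ m)) := by
          rw [← Finset.mul_sum]
          exact mul_le_mul_of_nonneg_left (hsum m M) (by positivity)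
      _ = _ := by ring
  have htrunc : ∀ (x : X) (m : ℕ),
      ‖J x - ∑ k ∈ (Finset.range m).biUnion G, fourierCoef (J x) k • charL2 k‖ ≤
        √(16 ^ d * S * (((m : ℝ) + 1) ^ (d - 1) * q ^ m)) * ‖x‖ := by
    intro x m
    rw [← Real.sqrt_sq (norm_nonneg x), ← Real.sqrt_mul (by positivity)]
    refine Real.le_sqrt_of_sq_le (norm_sq_sub_sum_le _ _ fun F => ?_)
    convert htail x m F using 4 with k
    simp [hG]
  have hbound : ∀ x, ‖J x‖ ≤ √(16 ^ d * S) * ‖x‖ := fun x => by simpa using htrunc x 0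
  refine ⟨J.mkContinuous _ hbound, fun x => rfl, 16 ^ d * S, by positivity, fun m n hn => ?_⟩
  set T := J.mkContinuous _ hbound
  let A : X →L[ℂ] Lp ℂ 2 (torusMeasure d) := ∑ k ∈ (Finset.range m).biUnion G,
    ((innerSL ℂ (charL2 k)).comp T).smulRight (charL2 k)
  have hA : ∀ x, A x = ∑ k ∈ (Finset.range m).biUnion G, fourierCoef (J x) k • charL2 k := by
    intro x
    simp [A, T, inner_charL2_left]
  have hrank : Module.rank ℂ (LinearMap.range (A : X →ₗ[ℂ] Lp ℂ 2 (torusMeasure d))) < n := by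
    have hle : LinearMap.range (A : X →ₗ[ℂ] Lp ℂ 2 (torusMeasure d)) ≤
        Submodule.span ℂ (((Finset.range m).biUnion G).image charL2 :
          Finset (Lp ℂ 2 (torusMeasure d))) := by
      rintro _ ⟨x, rfl⟩
      change A x ∈ _
      rw [hA]
      refine Submodule.sum_mem _ fun k hk => Submodule.smul_mem _ _ (Submodule.subset_span ?_)
      exact Finset.mem_coe.mpr (Finset.mem_image_of_mem _ hk)
    refine ((Submodule.rank_mono hle).trans (rank_span_finset_le _)).trans_lt ?_
    rw [Nat.cast_lt]
    refine lt_of_le_of_lt ?_ hn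
    refine Finset.card_image_le.trans (Finset.card_biUnion_le.trans ?_)
    refine (Finset.sum_le_sum fun s _ => hcard s).trans ?_
    rw [← Finset.mul_sum]
    exact Nat.mul_le_mul_left _ (sum_range_mul_two_pow_le _ _)
  refine (approxNum_le T A hrank).trans
    (ContinuousLinearMap.opNorm_le_bound _ (Real.sqrt_nonneg _) fun x => ?_)
  have := htrunc x m
  rwa [← hA] at this

end UpperBound

section Averaging

variable {d : ℕ}

lemma integral_norm_sq_sum_torusChar_smul {H : Type*} [NormedAddCommGroup H]
    [InnerProductSpace ℂ H] (K : Finset (ZLat d)) (v : ZLat d → H) :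
    ∫ y, ‖∑ k ∈ K, torusChar k y • v k‖ ^ 2 ∂torusMeasure d = ∑ k ∈ K, ‖v k‖ ^ 2 := by
  have key : ∀ y : Torus d, ((‖∑ k ∈ K, torusChar k y • v k‖ ^ 2 : ℝ) : ℂ) =
      ∑ k ∈ K, ∑ l ∈ K,
        (starRingEnd ℂ (torusChar k y) * torusChar l y) * inner ℂ (v k) (v l) := by
    intro y
    have h := inner_self_eq_norm_sq_to_K (𝕜 := ℂ) (∑ k ∈ K, torusChar k y • v k)
    push_cast
    refine h.symm.trans ?_
    rw [sum_inner]
    refine Finset.sum_congr rfl fun k _ => ?_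
    rw [inner_sum]
    refine Finset.sum_congr rfl fun l _ => ?_
    rw [inner_smul_left, inner_smul_right, mul_assoc]
  have hint : ∀ k l : ZLat d, Integrable (fun y : Torus d =>
      (starRingEnd ℂ (torusChar k y) * torusChar l y) * inner ℂ (v k) (v l))
      (torusMeasure d) := by
    intro k l
    refine Continuous.integrable_of_hasCompactSupport ?_ (HasCompactSupport.of_compactSpace _)
    have := continuous_torusChar k
    have := continuous_torusChar l
    fun_prop
  rw [← Complex.ofReal_inj, ← integral_complex_ofReal]
  simp_rw [key]
  rw [integral_finsetSum _ fun k _ => integrable_finsetSum _ fun l _ => hint k l,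
    Complex.ofReal_sum]
  refine Finset.sum_congr rfl fun k hk => ?_
  rw [integral_finsetSum _ fun l _ => hint k l]
  simp_rw [integral_mul_const, integral_conj_torusChar_mul]
  simp [hk, inner_self_eq_norm_sq_to_K]

lemma sum_norm_sq_le_of_forall {H : Type*} [NormedAddCommGroup H] [InnerProductSpace ℂ H]
    (K : Finset (ZLat d)) (v : ZLat d → H) {B : ℝ}
    (hB : ∀ y, ‖∑ k ∈ K, torusChar k y • v k‖ ^ 2 ≤ B) : ∑ k ∈ K, ‖v k‖ ^ 2 ≤ B := by
  rw [← integral_norm_sq_sum_torusChar_smul]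
  calc ∫ y, ‖∑ k ∈ K, torusChar k y • v k‖ ^ 2 ∂torusMeasure d
      ≤ ∫ _, B ∂torusMeasure d := by
        refine integral_mono ?_ (integrable_const B) hB
        refine Continuous.integrable_of_hasCompactSupport ?_ (HasCompactSupport.of_compactSpace _)
        have := continuous_torusChar (d := d)
        fun_prop
    _ = B := by simp

lemma one_sub_norm_sq_orthogonalProjectionOnto_le {H : Type*} [NormedAddCommGroup H]
    [InnerProductSpace ℂ H] (V : Submodule ℂ H) [V.HasOrthogonalProjection] {e a : H}
    (he : ‖e‖ = 1) (ha : a ∈ V) :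
    1 - ‖V.orthogonalProjectionOnto e‖ ^ 2 ≤ ‖e - a‖ ^ 2 := by
  have h1 : inner ℂ a e = inner ℂ a (V.orthogonalProjectionOnto e : H) :=
    (Submodule.inner_orthogonalProjectionOnto_eq_of_mem_left (⟨a, ha⟩ : V) e).symm
  have h2 := norm_sub_sq (𝕜 := ℂ) a e
  have h3 : RCLike.re (inner ℂ a e) ≤ ‖a‖ * ‖V.orthogonalProjectionOnto e‖ := by
    rw [h1]
    exact re_inner_le_norm a (V.orthogonalProjectionOnto e : H)
  rw [norm_sub_rev, h2, he]
  nlinarith [sq_nonneg (‖a‖ - ‖V.orthogonalProjectionOnto e‖)]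

/-- Orthonormal vectors are badly approximated on average by a subspace of small dimension. -/
lemma sum_norm_sq_orthogonalProjectionOnto_le {H ι : Type*} [NormedAddCommGroup H]
    [InnerProductSpace ℂ H] (V : Submodule ℂ H) [FiniteDimensional ℂ V] {e : ι → H}
    (he : Orthonormal ℂ e) (K : Finset ι) :
    ∑ k ∈ K, ‖V.orthogonalProjectionOnto (e k)‖ ^ 2 ≤ Module.finrank ℂ V := by
  let b := stdOrthonormalBasis ℂ V
  have h1 : ∀ k, ‖V.orthogonalProjectionOnto (e k)‖ ^ 2 =
      ∑ i, ‖inner ℂ (e k) (b i : H)‖ ^ 2 := by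
    intro k
    rw [← b.sum_sq_norm_inner_right]
    refine Finset.sum_congr rfl fun i _ => ?_
    rw [Submodule.inner_orthogonalProjectionOnto_eq_of_mem_left, norm_inner_symm]
  simp_rw [h1]
  rw [Finset.sum_comm]
  calc ∑ i, ∑ k ∈ K, ‖inner ℂ (e k) (b i : H)‖ ^ 2 ≤ ∑ i, ‖(b i : H)‖ ^ 2 :=
        Finset.sum_le_sum fun i _ => he.sum_inner_products_le _
    _ = Module.finrank ℂ V := by
        have hb : ∀ i, ‖(b i : H)‖ = 1 := fun i => b.orthonormal.1 i
        simp [hb]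

/-- If all translates of a polynomial with coefficients `c ∈ [0,1]` lie in the ball of radius `R`,
then a map of rank less than `n` cannot approximate the embedding too well. -/
lemma sum_sq_sub_le_of_translates {X : Type*} [NormedAddCommGroup X] [NormedSpace ℂ X]
    (T A : X →L[ℂ] Lp ℂ 2 (torusMeasure d)) (hT : Function.Injective T) {n : ℕ}
    (hA : Module.rank ℂ (LinearMap.range (A : X →ₗ[ℂ] Lp ℂ 2 (torusMeasure d))) < n)
    (K : Finset (ZLat d)) (c : ZLat d → ℝ) (hc0 : ∀ k, 0 ≤ c k) (hc1 : ∀ k, c k ≤ 1)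
    (hK : ∀ k ∈ K, ∃ x, T x = charL2 k) {R : ℝ}
    (hR : ∀ y, ∃ x, T x = ∑ k ∈ K, ((c k : ℂ) * torusChar k y) • charL2 k ∧ ‖x‖ ≤ R) :
    ∑ k ∈ K, c k ^ 2 - n ≤ (‖T - A‖ * R) ^ 2 := by
  set V := LinearMap.range (A : X →ₗ[ℂ] Lp ℂ 2 (torusMeasure d))
  have hfin : FiniteDimensional ℂ V :=
    Module.rank_lt_aleph0_iff.mp (hA.trans (Cardinal.natCast_lt_aleph0))
  have hVn : (Module.finrank ℂ V : ℝ) ≤ n := by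
    exact_mod_cast (Module.finrank_lt_of_rank_lt hA).le
  choose! e he using hK
  have hsum : ∑ k ∈ K, ‖(c k : ℂ) • (charL2 k - A (e k))‖ ^ 2 ≤ (‖T - A‖ * R) ^ 2 := by
    refine sum_norm_sq_le_of_forall K _ fun y => pow_le_pow_left₀ (norm_nonneg _) ?_ 2
    obtain ⟨x, hx, hxR⟩ := hR y
    have hxe : x = ∑ k ∈ K, ((c k : ℂ) * torusChar k y) • e k := by
      apply hT
      rw [hx, map_sum]
      refine Finset.sum_congr rfl fun k hk => ?_
      rw [map_smul, he k hk]
    have hval : ∑ k ∈ K, torusChar k y • (c k : ℂ) • (charL2 k - A (e k)) = (T - A) x := by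
      rw [hxe, map_sum]
      refine Finset.sum_congr rfl fun k hk => ?_
      rw [map_smul, sub_apply, he k hk, smul_smul, mul_comm (torusChar k y)]
    rw [hval]
    exact ((T - A).le_opNorm x).trans (mul_le_mul_of_nonneg_left hxR (norm_nonneg _))
  refine le_trans ?_ hsum
  have hproj := sum_norm_sq_orthogonalProjectionOnto_le V (orthonormal_charL2 (d := d)) K
  calc ∑ k ∈ K, c k ^ 2 - n
      ≤ ∑ k ∈ K, c k ^ 2 - ∑ k ∈ K, ‖V.orthogonalProjectionOnto (charL2 k)‖ ^ 2 := by linarith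
    _ = ∑ k ∈ K, (c k ^ 2 - ‖V.orthogonalProjectionOnto (charL2 k)‖ ^ 2) := by
        rw [Finset.sum_sub_distrib]
    _ ≤ _ := by
        refine Finset.sum_le_sum fun k _ => ?_
        have h := one_sub_norm_sq_orthogonalProjectionOnto_le V (orthonormal_charL2.1 k)
          (LinearMap.mem_range_self (A : X →ₗ[ℂ] Lp ℂ 2 (torusMeasure d)) (e k))
        have hc : c k ^ 2 ≤ 1 := pow_le_one₀ (hc0 k) (hc1 k)
        rw [norm_smul, mul_pow, Complex.norm_real, Real.norm_of_nonneg (hc0 k)]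
        have h' := mul_le_mul_of_nonneg_left h (sq_nonneg (c k))
        have h'' := mul_le_mul_of_nonneg_right hc
          (sq_nonneg ‖V.orthogonalProjectionOnto (charL2 k)‖)
        simp only [ContinuousLinearMap.coe_coe] at h'
        linarith

end Averaging

section FejerKernel

variable {d : ℕ}

/-- The Fourier coefficients of the Fejér-type kernel `|S|⁻¹ (∑_{a ∈ S} e^{i a·x})²`. -/
def fejerCoef (S : Finset (ZLat d)) (k : ZLat d) : ℝ :=
  {p ∈ S ×ˢ S | p.1 + p.2 = k}.card / S.card

lemma fejerCoef_nonneg (S : Finset (ZLat d)) (k : ZLat d) : 0 ≤ fejerCoef S k := by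
  unfold fejerCoef
  positivity

lemma fejerCoef_le_one (S : Finset (ZLat d)) (k : ZLat d) : fejerCoef S k ≤ 1 := by
  refine div_le_one_of_le₀ ?_ (by positivity)
  rw [Nat.cast_le]
  refine Finset.card_le_card_of_injOn Prod.fst ?_ ?_
  · intro p hp
    exact (Finset.mem_product.mp (Finset.mem_filter.mp hp).1).1
  · intro p hp q hq hpq
    have hp' := (Finset.mem_filter.mp hp).2
    have hq' := (Finset.mem_filter.mp hq).2
    refine Prod.ext hpq (add_left_cancel (a := p.1) ?_)
    rw [hp', hpq, hq']

lemma fejerCoef_eq_zero {S K : Finset (ZLat d)} (hK : ∀ a ∈ S, ∀ b ∈ S, a + b ∈ K)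
    {k : ZLat d} (hk : k ∉ K) : fejerCoef S k = 0 := by
  rw [fejerCoef, Finset.filter_false_of_mem, Finset.card_empty, Nat.cast_zero, zero_div]
  rintro p hp rfl
  exact hk (hK _ (Finset.mem_product.mp hp).1 _ (Finset.mem_product.mp hp).2)

lemma sum_fejerCoef_mul {S K : Finset (ZLat d)} (hK : ∀ a ∈ S, ∀ b ∈ S, a + b ∈ K)
    (u : ZLat d → ℂ) :
    ∑ k ∈ K, (fejerCoef S k : ℂ) * u k = (∑ p ∈ S ×ˢ S, u (p.1 + p.2)) / S.card := by
  rw [← Finset.sum_fiberwise_of_maps_to (s := S ×ˢ S) (t := K)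
    (g := fun p : ZLat d × ZLat d => p.1 + p.2) (f := fun p => u (p.1 + p.2)), Finset.sum_div]
  · refine Finset.sum_congr rfl fun k _ => ?_
    rw [Finset.sum_congr rfl fun p hp => congrArg u (Finset.mem_filter.mp hp).2,
      Finset.sum_const, nsmul_eq_mul, fejerCoef]
    push_cast
    ring
  · intro p hp
    exact hK _ (Finset.mem_product.mp hp).1 _ (Finset.mem_product.mp hp).2

lemma integral_norm_fejer_le {S K : Finset (ZLat d)} (hK : ∀ a ∈ S, ∀ b ∈ S, a + b ∈ K)
    (y : Torus d) :
    ∫ z, ‖∑ k ∈ K, (fejerCoef S k : ℂ) * torusChar k y * torusChar k z‖ ∂torusMeasure d ≤ 1 := by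
  have key : ∀ z : Torus d, ‖∑ k ∈ K, (fejerCoef S k : ℂ) * torusChar k y * torusChar k z‖ =
      ‖∑ a ∈ S, torusChar a z • torusChar a y‖ ^ 2 / S.card := by
    intro z
    simp_rw [mul_assoc]
    rw [sum_fejerCoef_mul hK fun k => torusChar k y * torusChar k z, norm_div, Complex.norm_natCast,
      ← norm_pow, sq, Finset.sum_mul_sum, ← Finset.sum_product']
    congr 2
    refine Finset.sum_congr rfl fun p _ => ?_
    simp only [torusChar_add, smul_eq_mul]
    ring
  simp_rw [key]
  rw [integral_div, integral_norm_sq_sum_torusChar_smul]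
  simp only [norm_torusChar, one_pow, Finset.sum_const, nsmul_eq_mul, mul_one]
  exact div_self_le_one _

lemma card_sq_le_card_mul_sum_fejerCoef_sq {S K : Finset (ZLat d)}
    (hK : ∀ a ∈ S, ∀ b ∈ S, a + b ∈ K) :
    (S.card : ℝ) ^ 2 ≤ K.card * ∑ k ∈ K, fejerCoef S k ^ 2 := by
  have h : ∑ k ∈ K, fejerCoef S k = S.card := by
    have h := sum_fejerCoef_mul hK fun _ => 1
    simp only [mul_one, Finset.sum_const, Finset.card_product, nsmul_eq_mul, Nat.cast_mul,
      mul_self_div_self] at h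
    exact_mod_cast h
  rw [← h]
  exact sq_sum_le_card_mul_sum_sq

end FejerKernel

section LowerBound

variable {d : ℕ} {ψ : ℝ → ℝ}

/-- A box of frequencies on which only one mixed dyadic block is nonzero. -/
def coreBox (i : Fin d → ℕ) : Finset (ZLat d) :=
  piFinset fun j => Finset.Ioc (6 * 2 ^ i j) (8 * 2 ^ i j)

/-- A box of frequencies whose pairwise sums lie in `coreBox i`. -/
def halfCoreBox (i : Fin d → ℕ) : Finset (ZLat d) :=
  piFinset fun j => Finset.Ioc (3 * 2 ^ i j) (4 * 2 ^ i j)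

lemma add_mem_coreBox (i : Fin d → ℕ) :
    ∀ a ∈ halfCoreBox i, ∀ b ∈ halfCoreBox i, a + b ∈ coreBox i := by
  intro a ha b hb
  rw [halfCoreBox, Fintype.mem_piFinset] at ha hb
  rw [coreBox, Fintype.mem_piFinset]
  intro j
  have ha' := Finset.mem_Ioc.mp (ha j)
  have hb' := Finset.mem_Ioc.mp (hb j)
  rw [Finset.mem_Ioc, Pi.add_apply]
  omega

lemma card_halfCoreBox (i : Fin d → ℕ) : (halfCoreBox i).card = 2 ^ ∑ j, i j := by
  rw [halfCoreBox, Fintype.card_piFinset, ← Finset.prod_pow_eq_pow_sum]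
  refine Finset.prod_congr rfl fun j _ => ?_
  rw [Int.card_Ioc, ← sub_mul, show (4 - 3 : ℤ) * 2 ^ i j = (2 ^ i j : ℕ) by push_cast; ring,
    Int.toNat_natCast]

lemma card_coreBox (i : Fin d → ℕ) : (coreBox i).card = 2 ^ d * 2 ^ ∑ j, i j := by
  have h : ∀ j, (Finset.Ioc (6 * 2 ^ i j : ℤ) (8 * 2 ^ i j)).card = 2 * 2 ^ i j := by
    intro j
    rw [Int.card_Ioc, ← sub_mul,
      show (8 - 6 : ℤ) * 2 ^ i j = (2 * 2 ^ i j : ℕ) by push_cast; ring, Int.toNat_natCast]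
  simp_rw [coreBox, Fintype.card_piFinset, h]
  rw [Finset.prod_mul_distrib, Finset.prod_const, Finset.card_univ, Fintype.card_fin,
    Finset.prod_pow_eq_pow_sum]

lemma phiProd_of_mem_coreBox (hψsupp : ∀ ξ : ℝ, 3 / 2 < |ξ| → ψ ξ = 0)
    (hψone : ∀ ξ : ℝ, |ξ| ≤ 1 → ψ ξ = 1) {i : Fin d → ℕ} {k : ZLat d} (hk : k ∈ coreBox i)
    (ℓ : Fin d → ℕ) : phiProd ψ ℓ k = if ℓ = i + 3 then 1 else 0 := by
  have h : ∀ j, phi1 ψ (ℓ j) (k j) = if ℓ j = i j + 3 then 1 else 0 := by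
    intro j
    have hj := Finset.mem_Ioc.mp (Fintype.mem_piFinset.mp hk j)
    have h₁ : (6 * 2 ^ i j : ℝ) < k j := by exact_mod_cast hj.1
    have h₂ : (k j : ℝ) ≤ 8 * 2 ^ i j := by exact_mod_cast hj.2
    have h₀ : (0 : ℝ) < k j := lt_trans (by positivity) h₁
    apply phi1_core hψsupp hψone (by omega)
    · rw [abs_of_pos h₀, pow_add]
      linarith
    · rw [abs_of_pos h₀, pow_add]
      linarith
  have hℓ : (∀ j, ℓ j = i j + 3) ↔ ℓ = i + 3 := funext_iff.symm
  simp_rw [phiProd, h, Fintype.prod_boole, hℓ]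

lemma eq_of_mem_coreBox {i i' : Fin d → ℕ} {k : ZLat d} (h : k ∈ coreBox i)
    (h' : k ∈ coreBox i') : i = i' := by
  have key : ∀ a b c : ℕ, (6 * 2 ^ a : ℤ) < c → (c : ℤ) ≤ 8 * 2 ^ b → a ≤ b := by
    intro a b c h₁ h₂
    by_contra! hab
    have : (2 : ℤ) ^ (b + 1) ≤ 2 ^ a := pow_le_pow_right₀ one_le_two hab
    have hb : (0 : ℤ) < 2 ^ b := by positivity
    rw [pow_succ] at this
    omega
  funext j
  have hj := Finset.mem_Ioc.mp (Fintype.mem_piFinset.mp h j)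
  have hj' := Finset.mem_Ioc.mp (Fintype.mem_piFinset.mp h' j)
  have h₀ : 0 ≤ k j := le_trans (by positivity) hj.1.le
  lift k j to ℕ using h₀ with c
  exact le_antisymm (key _ _ c hj.1 hj'.2) (key _ _ c hj'.1 hj.2)

lemma pairwiseDisjoint_coreBox (I : Finset (Fin d → ℕ)) :
    (I : Set (Fin d → ℕ)).PairwiseDisjoint coreBox := fun _ _ _ _ hne =>
  Finset.disjoint_left.mpr fun _ h h' => hne (eq_of_mem_coreBox h h')

lemma fourierCoef_sum_smul (K : Finset (ZLat d)) (a : ZLat d → ℂ) (k : ZLat d) :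
    fourierCoef (∑ l ∈ K, a l • charL2 l : Lp ℂ 2 (torusMeasure d)) k =
      if k ∈ K then a k else 0 := by
  rw [← inner_charL2_left, inner_sum]
  simp_rw [inner_smul_right, inner_charL2_left, fourierCoef_charL2]
  simp

lemma mixedBlock_sum_smul (K : Finset (ZLat d)) (a : ZLat d → ℂ) (ℓ : Fin d → ℕ) (z : Torus d) :
    mixedBlock ψ (∑ l ∈ K, a l • charL2 l : Lp ℂ 2 (torusMeasure d)) ℓ z =
      ∑ k ∈ K, (phiProd ψ ℓ k : ℂ) * a k * torusChar k z := by
  rw [mixedBlock_eq_sum (K := K)]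
  · refine Finset.sum_congr rfl fun k hk => ?_
    rw [fourierCoef_sum_smul, if_pos hk]
  · intro k hk
    rw [fourierCoef_sum_smul, if_neg hk, mul_zero]

/-- The mixed dyadic blocks of a polynomial with frequencies in disjoint core boxes are its
restrictions to the boxes. -/
lemma mixedBlock_sum_coreBox (hψsupp : ∀ ξ : ℝ, 3 / 2 < |ξ| → ψ ξ = 0)
    (hψone : ∀ ξ : ℝ, |ξ| ≤ 1 → ψ ξ = 1) (I : Finset (Fin d → ℕ)) (a : ZLat d → ℂ)
    (ℓ : Fin d → ℕ) (z : Torus d) :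
    mixedBlock ψ (∑ l ∈ I.biUnion coreBox, a l • charL2 l : Lp ℂ 2 (torusMeasure d)) ℓ z =
      ∑ i ∈ I with ℓ = i + 3, ∑ k ∈ coreBox i, a k * torusChar k z := by
  rw [mixedBlock_sum_smul, Finset.sum_biUnion (pairwiseDisjoint_coreBox I), Finset.sum_filter]
  refine Finset.sum_congr rfl fun i _ => ?_
  split_ifs with h
  · refine Finset.sum_congr rfl fun k hk => ?_
    rw [phiProd_of_mem_coreBox hψsupp hψone hk, if_pos h, Complex.ofReal_one, one_mul]
  · refine Finset.sum_eq_zero fun k hk => ?_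
    rw [phiProd_of_mem_coreBox hψsupp hψone hk, if_neg h, Complex.ofReal_zero, zero_mul, zero_mul]

lemma mul_integral_norm_mixedBlock_le (hψsupp : ∀ ξ : ℝ, 3 / 2 < |ξ| → ψ ξ = 0)
    (hψone : ∀ ξ : ℝ, |ξ| ≤ 1 → ψ ξ = 1) {t : ℝ} {m : ℕ} {I : Finset (Fin d → ℕ)}
    (hI : ∀ i ∈ I, ∑ j, i j = m) {a : ZLat d → ℂ}
    (ha : ∀ i ∈ I, ∫ z, ‖∑ k ∈ coreBox i, a k * torusChar k z‖ ∂torusMeasure d ≤ 1)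
    (ℓ : Fin d → ℕ) :
    (2 : ℝ) ^ ((∑ j, (ℓ j : ℝ)) * t) * ∫ z, ‖mixedBlock ψ
      (∑ l ∈ I.biUnion coreBox, a l • charL2 l : Lp ℂ 2 (torusMeasure d)) ℓ z‖ ∂torusMeasure d ≤
      (2 : ℝ) ^ (((m : ℝ) + 3 * d) * t) := by
  simp_rw [mixedBlock_sum_coreBox hψsupp hψone]
  by_cases h : ∃ i ∈ I, ℓ = i + 3
  · obtain ⟨i, hi, rfl⟩ := h
    have hfilter : {i' ∈ I | i + 3 = i' + 3} = {i} := by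
      ext i'
      simp only [Finset.mem_filter, add_left_inj, Finset.mem_singleton]
      exact ⟨fun h => h.2.symm, by rintro rfl; exact ⟨hi, rfl⟩⟩
    have hexp : ∑ j, (((i + 3) j : ℕ) : ℝ) = m + 3 * d := by
      rw [← hI i hi]
      simp [Finset.sum_add_distrib, mul_comm]
    simp_rw [hfilter, Finset.sum_singleton]
    rw [hexp]
    exact mul_le_of_le_one_right (by positivity) (ha i hi)
  · have hfilter : {i ∈ I | ℓ = i + 3} = ∅ :=
      Finset.filter_false_of_mem fun i hi hℓ => h ⟨i, hi, hℓ⟩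
    simp_rw [hfilter, Finset.sum_empty, norm_zero, integral_zero, mul_zero]
    positivity

lemma exists_norm_le_of_blocks_le {t : ℝ} {X : Type*} [NormedAddCommGroup X] [NormedSpace ℂ X]
    {J : X →ₗ[ℂ] Lp ℂ 2 (torusMeasure d)}
    (hJnorm : ∀ x : X, ‖x‖ = ⨆ ℓ : Fin d → ℕ,
      (2 : ℝ) ^ ((∑ j, (ℓ j : ℝ)) * t) *
        ∫ z, ‖mixedBlock ψ (⇑(J x)) ℓ z‖ ∂torusMeasure d)
    (hJsurj : ∀ f : Lp ℂ 2 (torusMeasure d),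
      BddAbove (Set.range fun ℓ : Fin d → ℕ =>
        (2 : ℝ) ^ ((∑ j, (ℓ j : ℝ)) * t) *
          ∫ z, ‖mixedBlock ψ (⇑f) ℓ z‖ ∂torusMeasure d) →
      ∃ x, J x = f) {f : Lp ℂ 2 (torusMeasure d)} {R : ℝ}
    (hR : ∀ ℓ : Fin d → ℕ, (2 : ℝ) ^ ((∑ j, (ℓ j : ℝ)) * t) *
      ∫ z, ‖mixedBlock ψ (⇑f) ℓ z‖ ∂torusMeasure d ≤ R) :
    ∃ x, J x = f ∧ ‖x‖ ≤ R := by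
  obtain ⟨x, hx⟩ := hJsurj f ⟨R, by rintro _ ⟨ℓ, rfl⟩; exact hR ℓ⟩
  refine ⟨x, hx, ?_⟩
  rw [hJnorm, hx]
  exact ciSup_le hR

lemma le_approxNum (hd : 0 < d) {t : ℝ}
    (hψsupp : ∀ ξ : ℝ, 3 / 2 < |ξ| → ψ ξ = 0) (hψone : ∀ ξ : ℝ, |ξ| ≤ 1 → ψ ξ = 1)
    {X : Type*} [NormedAddCommGroup X] [NormedSpace ℂ X]
    {J : X →ₗ[ℂ] Lp ℂ 2 (torusMeasure d)} (hJinj : Function.Injective J)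
    (hJnorm : ∀ x : X, ‖x‖ = ⨆ ℓ : Fin d → ℕ,
      (2 : ℝ) ^ ((∑ j, (ℓ j : ℝ)) * t) *
        ∫ z, ‖mixedBlock ψ (⇑(J x)) ℓ z‖ ∂torusMeasure d)
    (hJsurj : ∀ f : Lp ℂ 2 (torusMeasure d),
      BddAbove (Set.range fun ℓ : Fin d → ℕ =>
        (2 : ℝ) ^ ((∑ j, (ℓ j : ℝ)) * t) *
          ∫ z, ‖mixedBlock ψ (⇑f) ℓ z‖ ∂torusMeasure d) →
      ∃ x, J x = f)
    {T : X →L[ℂ] Lp ℂ 2 (torusMeasure d)} (hT : ∀ x, T x = J x) {m n : ℕ} (hn : 1 ≤ n)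
    (hmn : 2 ^ (d + 1) * d ^ (d - 1) * n ≤ (m + 1) ^ (d - 1) * 2 ^ m) :
    √n / (2 : ℝ) ^ (((m : ℝ) + 3 * d) * t) ≤ approxNum T n := by
  classical
  set R : ℝ := (2 : ℝ) ^ (((m : ℝ) + 3 * d) * t) with hR
  have hRpos : 0 < R := by positivity
  set I := piAntidiag (Finset.univ : Finset (Fin d)) m
  have hI : ∀ i ∈ I, ∑ j, i j = m := fun i hi => (Finset.mem_piAntidiag.mp hi).1
  set c : ZLat d → ℝ := fun k => ∑ i ∈ I, fejerCoef (halfCoreBox i) k with hc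
  have hcz : ∀ (i : Fin d → ℕ) (k : ZLat d), k ∉ coreBox i → fejerCoef (halfCoreBox i) k = 0 :=
    fun i k hk => fejerCoef_eq_zero (add_mem_coreBox i) hk
  have hcI : ∀ i ∈ I, ∀ k ∈ coreBox i, c k = fejerCoef (halfCoreBox i) k := by
    intro i hi k hk
    refine Finset.sum_eq_single_of_mem i hi fun i' _ hne => hcz i' k fun hk' => ?_
    exact hne (eq_of_mem_coreBox hk' hk)
  have hc0 : ∀ k, 0 ≤ c k := fun k => Finset.sum_nonneg fun i _ => fejerCoef_nonneg _ k
  have hc1 : ∀ k, c k ≤ 1 := by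
    intro k
    by_cases h : ∃ i ∈ I, k ∈ coreBox i
    · obtain ⟨i, hi, hk⟩ := h
      rw [hcI i hi k hk]
      exact fejerCoef_le_one _ k
    · refine (Finset.sum_nonpos fun i hi => (hcz i k fun hk => h ⟨i, hi, hk⟩).le).trans zero_le_one
  have hTinj : Function.Injective T := fun x y h => hJinj (by rwa [hT, hT] at h)
  have hex : ∀ a : ZLat d → ℂ,
      (∀ i ∈ I, ∫ z, ‖∑ k ∈ coreBox i, a k * torusChar k z‖ ∂torusMeasure d ≤ 1) →
      ∃ x, T x = ∑ k ∈ I.biUnion coreBox, a k • charL2 k ∧ ‖x‖ ≤ R := by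
    intro a ha
    simp_rw [hT]
    exact exists_norm_le_of_blocks_le hJnorm hJsurj
      (mul_integral_norm_mixedBlock_le hψsupp hψone hI ha)
  have hchar : ∀ k ∈ I.biUnion coreBox, ∃ x, T x = charL2 k := by
    intro k hk
    obtain ⟨x, hx, -⟩ := hex (fun l => if l = k then 1 else 0) fun i _ => by
      by_cases hki : k ∈ coreBox i <;> simp [hki, norm_torusChar]
    refine ⟨x, hx.trans ?_⟩
    rw [Finset.sum_eq_single_of_mem k hk fun l _ hl => by rw [if_neg hl, zero_smul], if_pos rfl,
      one_smul]
  have htrans : ∀ y, ∃ x, T x =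
      ∑ k ∈ I.biUnion coreBox, ((c k : ℂ) * torusChar k y) • charL2 k ∧ ‖x‖ ≤ R := by
    intro y
    refine hex (fun k => (c k : ℂ) * torusChar k y) fun i hi => ?_
    refine le_of_eq_of_le ?_ (integral_norm_fejer_le (add_mem_coreBox i) y)
    congr 1
    funext z
    congr 1
    exact Finset.sum_congr rfl fun k hk => by rw [hcI i hi k hk]
  have hsum : 2 * (n : ℝ) ≤ ∑ k ∈ I.biUnion coreBox, c k ^ 2 := by
    rw [Finset.sum_biUnion (pairwiseDisjoint_coreBox I)]
    have hi : ∀ i ∈ I, (2 : ℝ) ^ m / 2 ^ d ≤ ∑ k ∈ coreBox i, c k ^ 2 := by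
      intro i hi
      have h := card_sq_le_card_mul_sum_fejerCoef_sq (add_mem_coreBox i)
      rw [card_halfCoreBox, card_coreBox, hI i hi] at h
      rw [Finset.sum_congr rfl fun k hk => by rw [hcI i hi k hk], div_le_iff₀ (by positivity)]
      push_cast at h
      have h2 : (0 : ℝ) < 2 ^ m := by positivity
      nlinarith
    refine le_trans ?_ (Finset.sum_le_sum hi)
    have hcard : ((m : ℝ) + 1) ^ (d - 1) ≤ d ^ (d - 1) * I.card := by
      exact_mod_cast pow_le_card_piAntidiag_fin hd m
    have hmn' : (2 : ℝ) ^ (d + 1) * d ^ (d - 1) * n ≤ (m + 1) ^ (d - 1) * 2 ^ m := by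
      exact_mod_cast hmn
    rw [Finset.sum_const, nsmul_eq_mul, ← mul_div_assoc, le_div_iff₀ (by positivity)]
    have hd' : (0 : ℝ) < (d : ℝ) ^ (d - 1) := by positivity
    refine le_of_mul_le_mul_left ?_ hd'
    calc (d : ℝ) ^ (d - 1) * (2 * n * 2 ^ d) = 2 ^ (d + 1) * d ^ (d - 1) * n := by ring
      _ ≤ (m + 1) ^ (d - 1) * 2 ^ m := hmn'
      _ ≤ d ^ (d - 1) * I.card * 2 ^ m := mul_le_mul_of_nonneg_right hcard (by positivity)
      _ = _ := by ring
  refine le_csInf ⟨_, 0, ?_, rfl⟩ ?_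
  · simpa using Nat.pos_of_ne_zero (Nat.one_le_iff_ne_zero.mp hn)
  · rintro _ ⟨A, hA, rfl⟩
    have h := sum_sq_sub_le_of_translates T A hTinj hA _ c hc0 hc1 hchar htrans
    rw [div_le_iff₀ hRpos]
    exact Real.sqrt_le_iff.mpr ⟨by positivity, by linarith⟩

end LowerBound

section Asymptotics

lemma add_two_pow_mul_le (e m : ℕ) :
    (m + 1 + 1) ^ e * 2 ^ (m + 1) ≤ 2 ^ (e + 1) * ((m + 1) ^ e * 2 ^ m) := by
  calc (m + 1 + 1) ^ e * 2 ^ (m + 1) ≤ (2 * (m + 1)) ^ e * 2 ^ (m + 1) :=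
        Nat.mul_le_mul_right _ (Nat.pow_le_pow_left (by omega) e)
    _ = _ := by rw [mul_pow]; ring

lemma exists_level_above (e : ℕ) {c n : ℕ} (hc : 1 ≤ c) (hn : 2 ≤ n) :
    ∃ m, c * ((m + 1) ^ e * (2 ^ m - 1)) < n ∧ n ≤ c * 2 ^ (e + 1) * ((m + 1) ^ e * 2 ^ m) ∧
      2 ^ m ≤ n := by
  have hex : ∃ m, n ≤ c * ((m + 1) ^ e * (2 ^ m - 1)) := by
    refine ⟨n, ?_⟩
    have h1 : n ≤ 2 ^ n - 1 := Nat.le_sub_one_of_lt Nat.lt_two_pow_self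
    calc n ≤ 1 * (1 * (2 ^ n - 1)) := by simpa using h1
      _ ≤ _ := Nat.mul_le_mul hc (Nat.mul_le_mul_right _ (Nat.one_le_pow _ _ (by omega)))
  classical
  obtain ⟨m, hm⟩ : ∃ m, Nat.find hex = m + 1 := by
    refine Nat.exists_eq_succ_of_ne_zero fun h0 => ?_
    have := Nat.find_spec hex
    rw [h0] at this
    simp at this
    omega
  have hlt : c * ((m + 1) ^ e * (2 ^ m - 1)) < n :=
    not_le.mp (Nat.find_min hex (m := m) (by omega))
  refine ⟨m, hlt, ?_, ?_⟩
  · have h := Nat.find_spec hex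
    rw [hm] at h
    refine h.trans ?_
    rw [mul_assoc]
    refine Nat.mul_le_mul_left _ (le_trans ?_ (add_two_pow_mul_le e m))
    exact Nat.mul_le_mul_left _ (Nat.sub_le _ _)
  · have h : 1 * (1 * (2 ^ m - 1)) ≤ c * ((m + 1) ^ e * (2 ^ m - 1)) :=
      Nat.mul_le_mul hc (Nat.mul_le_mul_right _ (Nat.one_le_pow _ _ (by omega)))
    omega

lemma exists_level_below (e : ℕ) {c n : ℕ} (hc : 1 ≤ c) (hn : 2 ≤ n) :
    ∃ m, c * n ≤ (m + 1) ^ e * 2 ^ m ∧ (m + 1) ^ e * 2 ^ m ≤ 2 ^ (e + 1) * (c * n) := by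
  have hex : ∃ m, c * n ≤ (m + 1) ^ e * 2 ^ m := by
    refine ⟨c * n, ?_⟩
    calc c * n ≤ 1 * 2 ^ (c * n) := by simpa using Nat.lt_two_pow_self.le
      _ ≤ _ := Nat.mul_le_mul_right _ (Nat.one_le_pow _ _ (by omega))
  classical
  obtain ⟨m, hm⟩ : ∃ m, Nat.find hex = m + 1 := by
    refine Nat.exists_eq_succ_of_ne_zero fun h0 => ?_
    have := Nat.find_spec hex
    rw [h0] at this
    simp at this
    nlinarith
  refine ⟨m + 1, hm ▸ Nat.find_spec hex, (add_two_pow_mul_le e m).trans ?_⟩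
  exact Nat.mul_le_mul_left _ (not_le.mp (Nat.find_min hex (m := m) (by omega))).le

lemma sqrt_pow_mul_rpow {x : ℝ} (hx : 0 < x) (e m : ℕ) (t : ℝ) :
    √(x ^ e * ((2 : ℝ) ^ (1 - 2 * t)) ^ m) =
      x ^ ((e : ℝ) * t) * (x ^ e * 2 ^ m) ^ ((1 : ℝ) / 2 - t) := by
  rw [Real.sqrt_eq_iff_mul_self_eq (by positivity) (by positivity),
    Real.mul_rpow (by positivity) (by positivity)]
  simp only [← Real.rpow_natCast, ← Real.rpow_mul hx.le, ← Real.rpow_mul zero_le_two]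
  have hmul : ∀ a b c : ℝ, a * (b * c) * (a * (b * c)) = a * b * (a * b) * (c * c) :=
    fun a b c => by ring
  rw [hmul, ← Real.rpow_add hx, ← Real.rpow_add hx, ← Real.rpow_add two_pos]
  ring_nf

lemma exists_level_upper (d : ℕ) {t C : ℝ} (ht : 1 / 2 < t) (hC : 0 < C) :
    ∃ B : ℝ, 0 < B ∧ ∀ n : ℕ, 2 ≤ n → ∃ m : ℕ,
      4 ^ d * ((m + 1) ^ (d - 1) * (2 ^ m - 1)) < n ∧
      √(C * (((m : ℝ) + 1) ^ (d - 1) * ((2 : ℝ) ^ (1 - 2 * t)) ^ m)) ≤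
        B * Real.log n ^ (((d - 1 : ℕ) : ℝ) * t) * (n : ℝ) ^ ((1 : ℝ) / 2 - t) := by
  set e := d - 1
  set D : ℝ := 4 ^ d * 2 ^ (e + 1) with hD
  have hlog2 : 0 < Real.log 2 := Real.log_pos one_lt_two
  refine ⟨√C * (2 / Real.log 2) ^ ((e : ℝ) * t) * (1 / D) ^ ((1 : ℝ) / 2 - t), by positivity,
    fun n hn => ?_⟩
  obtain ⟨m, hm, hnm, h2m⟩ := exists_level_above e (Nat.one_le_pow d 4 (by norm_num)) hn
  refine ⟨m, hm, ?_⟩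
  have hn0 : (0 : ℝ) < n := by positivity
  have hlogn : Real.log 2 ≤ Real.log n := Real.log_le_log two_pos (by exact_mod_cast hn)
  have hmlog : (m : ℝ) * Real.log 2 ≤ Real.log n := by
    rw [← Real.log_pow]
    exact Real.log_le_log (by positivity) (by exact_mod_cast h2m)
  have hm1 : (m : ℝ) + 1 ≤ 2 / Real.log 2 * Real.log n := by
    rw [div_mul_eq_mul_div, le_div_iff₀ hlog2]
    linarith
  have hN : 1 / D * n ≤ ((m : ℝ) + 1) ^ e * 2 ^ m := by
    rw [div_mul_eq_mul_div, div_le_iff₀ (by positivity), one_mul, mul_comm, hD]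
    exact_mod_cast hnm
  rw [Real.sqrt_mul hC.le, sqrt_pow_mul_rpow (by positivity)]
  have h1 : ((m : ℝ) + 1) ^ ((e : ℝ) * t) ≤
      (2 / Real.log 2) ^ ((e : ℝ) * t) * Real.log n ^ ((e : ℝ) * t) := by
    rw [← Real.mul_rpow (by positivity) (hlog2.le.trans hlogn)]
    exact Real.rpow_le_rpow (by positivity) hm1 (mul_nonneg (by positivity) (by linarith))
  have h2 : (((m : ℝ) + 1) ^ e * 2 ^ m) ^ ((1 : ℝ) / 2 - t) ≤
      (1 / D) ^ ((1 : ℝ) / 2 - t) * (n : ℝ) ^ ((1 : ℝ) / 2 - t) := by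
    rw [← Real.mul_rpow (by positivity) hn0.le]
    exact Real.rpow_le_rpow_of_nonpos (by positivity) hN (by linarith)
  calc _ ≤ √C * (((2 / Real.log 2) ^ ((e : ℝ) * t) * Real.log n ^ ((e : ℝ) * t)) *
        ((1 / D) ^ ((1 : ℝ) / 2 - t) * (n : ℝ) ^ ((1 : ℝ) / 2 - t))) := by gcongr
    _ = _ := by ring

lemma exists_level_lower {d : ℕ} (hd : 0 < d) {t : ℝ} (ht : 0 < t) :
    ∃ A : ℝ, 0 < A ∧ ∀ n : ℕ, 2 ≤ n → ∃ m : ℕ,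
      2 ^ (d + 1) * d ^ (d - 1) * n ≤ (m + 1) ^ (d - 1) * 2 ^ m ∧
      A * Real.log n ^ (((d - 1 : ℕ) : ℝ) * t) * (n : ℝ) ^ ((1 : ℝ) / 2 - t) ≤
        √n / (2 : ℝ) ^ (((m : ℝ) + 3 * d) * t) := by
  obtain ⟨e, rfl⟩ : ∃ e, d = e + 1 := ⟨d - 1, by omega⟩
  rw [Nat.add_sub_cancel]
  set K : ℕ := 2 ^ (e + 1 + 1) * (e + 1) ^ e with hK
  have hK1 : 1 ≤ K := Nat.one_le_iff_ne_zero.mpr (by positivity)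
  have hK0 : (0 : ℝ) < K := by exact_mod_cast hK1
  set D : ℝ := 2 ^ (e + 1) * K with hD
  set G : ℝ := (2 : ℝ) ^ (3 * ((e + 1 : ℕ) : ℝ) * t) with hG
  refine ⟨(((e : ℝ) + 1) ^ ((e : ℝ) * t) * D ^ t * G)⁻¹, by positivity, fun n hn => ?_⟩
  obtain ⟨m, hm, hnm⟩ := exists_level_below e hK1 hn
  refine ⟨m, hm, ?_⟩
  have hn0 : (0 : ℝ) < n := by positivity
  have hlogn : 0 ≤ Real.log n := Real.log_natCast_nonneg n
  set x : ℝ := (m : ℝ) + 1 with hx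
  have hx0 : 0 < x := by positivity
  have hn2 : (n : ℝ) ≤ 2 ^ ((e + 1) * m) := by
    have h1 : (m + 1) ^ e ≤ (2 ^ m) ^ e := Nat.pow_le_pow_left Nat.lt_two_pow_self e
    have : n ≤ 2 ^ ((e + 1) * m) := by
      calc n ≤ K * n := Nat.le_mul_of_pos_left n hK1
        _ ≤ (m + 1) ^ e * 2 ^ m := hm
        _ ≤ (2 ^ m) ^ e * 2 ^ m := Nat.mul_le_mul_right _ h1
        _ = _ := by ring
    exact_mod_cast this
  have hlog : Real.log n ≤ ((e : ℝ) + 1) * x := by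
    calc Real.log n ≤ Real.log (2 ^ ((e + 1) * m)) := Real.log_le_log hn0 hn2
      _ = ((e : ℝ) + 1) * m * Real.log 2 := by rw [Real.log_pow]; push_cast; ring
      _ ≤ ((e : ℝ) + 1) * m * 1 :=
        mul_le_mul_of_nonneg_left (Real.log_two_lt_d9.le.trans (by norm_num)) (by positivity)
      _ ≤ _ := by rw [mul_one]; exact mul_le_mul_of_nonneg_left (by simp [hx]) (by positivity)
  have h1 : Real.log n ^ ((e : ℝ) * t) ≤ ((e : ℝ) + 1) ^ ((e : ℝ) * t) * x ^ ((e : ℝ) * t) := by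
    rw [← Real.mul_rpow (by positivity) hx0.le]
    exact Real.rpow_le_rpow hlogn hlog (by positivity)
  have h2 : x ^ ((e : ℝ) * t) * (2 : ℝ) ^ ((m : ℝ) * t) ≤ D ^ t * (n : ℝ) ^ t := by
    rw [Real.rpow_mul hx0.le, Real.rpow_mul zero_le_two, Real.rpow_natCast, Real.rpow_natCast,
      ← Real.mul_rpow (by positivity) (by positivity),
      ← Real.mul_rpow (by positivity) (by positivity)]
    refine Real.rpow_le_rpow (by positivity) ?_ ht.le
    rw [hD, mul_assoc, hx]
    exact_mod_cast hnm
  have hsplit : (2 : ℝ) ^ (((m : ℝ) + 3 * ((e + 1 : ℕ) : ℝ)) * t) = 2 ^ ((m : ℝ) * t) * G := by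
    rw [hG, ← Real.rpow_add two_pos, add_mul]
  have hG0 : 0 < G := by positivity
  rw [hsplit, Real.rpow_sub hn0, ← Real.sqrt_eq_rpow, le_div_iff₀ (by positivity)]
  calc _ ≤ (((e : ℝ) + 1) ^ ((e : ℝ) * t) * D ^ t * G)⁻¹ *
        (((e : ℝ) + 1) ^ ((e : ℝ) * t) * x ^ ((e : ℝ) * t)) * (√n / (n : ℝ) ^ t) *
          ((2 : ℝ) ^ ((m : ℝ) * t) * G) := by gcongr
    _ = √n * ((x ^ ((e : ℝ) * t) * (2 : ℝ) ^ ((m : ℝ) * t)) / (D ^ t * (n : ℝ) ^ t)) := by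
        field_simp
    _ ≤ √n := mul_le_of_le_one_right (by positivity) (div_le_one_of_le₀ h2 (by positivity))

end Asymptotics

/-- Corollary 11 of Cobos–Kühn–Sickel. Let `t > 1/2` and let `X` be
(an isometric copy of) the Besov space `S^t_{1,∞}B(𝕋^d)` of dominating mixed
smoothness: `X` consists of all `f ∈ L₂(𝕋^d)` with finite norm
`sup_{ℓ∈ℕ₀^d} 2^{|ℓ|₁ t} ‖f_ℓ‖_{L¹(𝕋^d)}`, realized by an injective linear map
`J : X → L₂(𝕋^d)` which is norm-preserving and onto the set of `f ∈ L₂` with finite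
Besov norm.  Then the identity map `I_d : X → L₂(𝕋^d)` is bounded and there are
constants `0 < A ≤ B < ∞` with
`A (ln n)^{(d-1)t} n^{1/2-t} ≤ a_n(I_d : X → L₂(𝕋^d)) ≤ B (ln n)^{(d-1)t} n^{1/2-t}`
for all `n ≥ 2`. -/
theorem statement17 (d : ℕ) (hd : 0 < d) (t : ℝ) (ht : 1 / 2 < t) (ψ : ℝ → ℝ)
    (hψsmooth : ContDiff ℝ (⊤ : ℕ∞) ψ)
    (hψsupp : ∀ ξ : ℝ, 3 / 2 < |ξ| → ψ ξ = 0)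
    (hψone : ∀ ξ : ℝ, |ξ| ≤ 1 → ψ ξ = 1)
    (hψnonneg : ∀ ξ, 0 ≤ ψ ξ)
    (hψmono : ∀ ξ, ψ ξ ≤ ψ (ξ / 2))
    (X : Type) [NormedAddCommGroup X] [NormedSpace ℂ X]
    (J : X →ₗ[ℂ] Lp ℂ 2 (torusMeasure d)) (hJinj : Function.Injective J)
    (hJnorm : ∀ x : X, ‖x‖ = ⨆ ℓ : Fin d → ℕ,
      (2 : ℝ) ^ ((∑ j, (ℓ j : ℝ)) * t) *
        ∫ z, ‖mixedBlock ψ (⇑(J x)) ℓ z‖ ∂torusMeasure d)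
    (hJsurj : ∀ f : Lp ℂ 2 (torusMeasure d),
      BddAbove (Set.range fun ℓ : Fin d → ℕ =>
        (2 : ℝ) ^ ((∑ j, (ℓ j : ℝ)) * t) *
          ∫ z, ‖mixedBlock ψ (⇑f) ℓ z‖ ∂torusMeasure d) →
      ∃ x, J x = f) :
    ∃ T : X →L[ℂ] Lp ℂ 2 (torusMeasure d), (∀ x : X, T x = J x) ∧
      ∃ A B : ℝ, 0 < A ∧ A ≤ B ∧
        ∀ n : ℕ, 2 ≤ n →
          A * Real.log n ^ (((d : ℝ) - 1) * t) * (n : ℝ) ^ ((1 : ℝ) / 2 - t) ≤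
              approxNum T n ∧
            approxNum T n ≤
              B * Real.log n ^ (((d : ℝ) - 1) * t) * (n : ℝ) ^ ((1 : ℝ) / 2 - t) := by
  obtain ⟨T, hT, C, hC, hupper⟩ := exists_embedding_approxNum_le hd ht hψsupp hψone J hJnorm
  obtain ⟨B, -, hB⟩ := exists_level_upper d ht hC
  obtain ⟨A, hA, hlower⟩ := exists_level_lower hd (show 0 < t by linarith)
  have hbounds : ∀ n : ℕ, 2 ≤ n →
      A * Real.log n ^ (((d : ℝ) - 1) * t) * (n : ℝ) ^ ((1 : ℝ) / 2 - t) ≤ approxNum T n ∧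
        approxNum T n ≤
          B * Real.log n ^ (((d : ℝ) - 1) * t) * (n : ℝ) ^ ((1 : ℝ) / 2 - t) := by
    intro n hn
    have hd1 : ((d : ℝ) - 1) = ((d - 1 : ℕ) : ℝ) := by rw [Nat.cast_sub hd, Nat.cast_one]
    rw [hd1]
    obtain ⟨m₁, hm₁, h₁⟩ := hlower n hn
    obtain ⟨m₂, hm₂, h₂⟩ := hB n hn
    exact ⟨h₁.trans (le_approxNum hd hψsupp hψone hJinj hJnorm hJsurj hT (by omega) hm₁),
      (hupper m₂ n hm₂).trans h₂⟩
  refine ⟨T, hT, A, B, hA, ?_, hbounds⟩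
  have hlog : 0 < Real.log (2 : ℕ) := Real.log_pos (by norm_num)
  have h := (hbounds 2 le_rfl).1.trans (hbounds 2 le_rfl).2
  exact le_of_mul_le_mul_right (le_of_mul_le_mul_right h (by positivity)) (by positivity)
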